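/- Let d and d' be positive integers, let v ∈ ℝ^d with ‖v‖₂ = 1, and let h : [d] → [d'] and sgn : [d] → {−1,+1} be independent uniformly random functions. Define v' ∈ ℝ^{d'} by v'_i = Σ_{j : h(j) = i} sgn(j)·v_j, the prefix vectors v'^{(k)} by v'^{(k)}_i = Σ_{j ≤ k, h(j) = i} sgn(j)·v_j, the increments X_k = ‖v'^{(k)}‖₂² − ‖v'^{(k−1)}‖₂² − v_k², partial sums X_{≤k} = Σ_{i=1}^k X_i, and V_k = Σ_{i=1}^k E[X_i² | X₁,…,X_{i−1}]. Then for every ε ∈ (0,1): Pr[|‖v'‖₂² − 1| ≥ ε] ≤ Pr[∃k ∈ {1,…,d} : |X_{≤k}| ≥ ε and V_k ≤ 8/d']. -/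

import Mathlib

open MeasureTheory ProbabilityTheory Real Finset

noncomputable section

/-- Sample space for the random hash functions `h : [d] → [d']` and `sgn : [d] → {-1,+1}`. -/
abbrev HashOmega (d d' : ℕ) : Type := (Fin d → Fin d') × (Fin d → Bool)

/-- The uniform probability measure on `HashOmega d d'`; this encodes that all values
`h(j)`, `sgn(j)` are mutually independent and uniformly distributed. -/
noncomputable def hashUnif (d d' : ℕ) [NeZero d'] : Measure (HashOmega d d') :=
  (PMF.uniformOfFintype (HashOmega d d')).toMeasure

/-- The sign `sgn(j) ∈ {-1,+1}` of coordinate `j` at sample point `ω`. -/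
def hashSgn {d d' : ℕ} (ω : HashOmega d d') (j : Fin d) : ℝ :=
  if ω.2 j then 1 else -1

/-- The prefix vector `v'^{(k)} ∈ ℝ^{d'}`: feature hashing applied to the first `k`
coordinates of `v`, i.e. `v'^{(k)}_i = ∑_{j ≤ k, h(j) = i} sgn(j)·v_j`.
For `k = d` this is the feature-hashed vector `v'` itself. -/
def prefixVec {d : ℕ} (d' : ℕ) (v : Fin d → ℝ) (k : ℕ) (ω : HashOmega d d') :
    Fin d' → ℝ :=
  fun i => ∑ j ∈ univ.filter (fun j : Fin d => (j : ℕ) < k ∧ ω.1 j = i),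
    hashSgn ω j * v j

/-- Squared euclidean norm of a vector in `ℝ^n`. -/
def sqNorm {n : ℕ} (w : Fin n → ℝ) : ℝ := ∑ i, (w i) ^ 2

/-- The martingale increments `X_k = ‖v'^{(k)}‖₂² − ‖v'^{(k−1)}‖₂² − v_k²`
(with `k` 1-indexed in the paper, so `Xinc d' v j` for `j : Fin d` is `X_{j+1}`). -/
def Xinc {d : ℕ} (d' : ℕ) (v : Fin d → ℝ) (j : Fin d) (ω : HashOmega d d') : ℝ :=
  sqNorm (prefixVec d' v ((j : ℕ) + 1) ω) - sqNorm (prefixVec d' v (j : ℕ) ω) - (v j) ^ 2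

/-- The σ-algebra generated by `X₁, …, X_{k−1}`, i.e. by the increments `Xinc d' v i`
for `i < j`. -/
def XFilt {d : ℕ} (d' : ℕ) (v : Fin d → ℝ) (j : Fin d) : MeasurableSpace (HashOmega d d') :=
  ⨆ (i : Fin d) (_ : i < j), MeasurableSpace.comap (Xinc d' v i) inferInstance

lemma filter_val_lt_succ {d k : ℕ} (hk : k < d) :
    univ.filter (fun j : Fin d => (j : ℕ) < k + 1) =
      insert ⟨k, hk⟩ (univ.filter (fun j : Fin d => (j : ℕ) < k)) := by
  ext j
  simp only [mem_filter, mem_univ, true_and, mem_insert, Fin.ext_iff]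
  omega

lemma sum_filter_val_lt_succ {d k : ℕ} (hk : k < d) (f : Fin d → ℝ) :
    ∑ j ∈ univ.filter (fun j : Fin d => (j : ℕ) < k + 1), f j =
      f ⟨k, hk⟩ + ∑ j ∈ univ.filter (fun j : Fin d => (j : ℕ) < k), f j := by
  rw [filter_val_lt_succ hk, sum_insert (by simp)]

lemma prefixVec_apply {d : ℕ} (d' : ℕ) (v : Fin d → ℝ) (k : ℕ) (ω : HashOmega d d')
    (i : Fin d') :
    prefixVec d' v k ω i = ∑ j ∈ univ.filter (fun j : Fin d => (j : ℕ) < k),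
      if ω.1 j = i then hashSgn ω j * v j else 0 := by
  rw [prefixVec, ← sum_filter, filter_filter]

lemma prefixVec_succ {d : ℕ} (d' : ℕ) (v : Fin d → ℝ) (j : Fin d) (ω : HashOmega d d')
    (i : Fin d') :
    prefixVec d' v ((j : ℕ) + 1) ω i =
      (if ω.1 j = i then hashSgn ω j * v j else 0) + prefixVec d' v j ω i := by
  rw [prefixVec_apply, prefixVec_apply, sum_filter_val_lt_succ j.isLt]

lemma hashSgn_sq {d d' : ℕ} (ω : HashOmega d d') (j : Fin d) : hashSgn ω j ^ 2 = 1 := by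
  unfold hashSgn
  split_ifs <;> norm_num

lemma Xinc_eq {d : ℕ} (d' : ℕ) (v : Fin d → ℝ) (j : Fin d) (ω : HashOmega d d') :
    Xinc d' v j ω = 2 * (hashSgn ω j * v j) * prefixVec d' v j ω (ω.1 j) := by
  have key : ∀ i, prefixVec d' v ((j : ℕ) + 1) ω i ^ 2 =
      prefixVec d' v j ω i ^ 2 + if ω.1 j = i then
        (hashSgn ω j * v j) ^ 2 + 2 * (hashSgn ω j * v j) * prefixVec d' v j ω i else 0 := by
    intro i
    rw [prefixVec_succ]
    split_ifs <;> ring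
  simp only [Xinc, sqNorm, key, sum_add_distrib, sum_ite_eq, mem_univ, if_true]
  rw [mul_pow, hashSgn_sq]
  ring

lemma Xinc_sq {d : ℕ} (d' : ℕ) (v : Fin d → ℝ) (j : Fin d) (ω : HashOmega d d') :
    Xinc d' v j ω ^ 2 = 4 * v j ^ 2 * prefixVec d' v j ω (ω.1 j) ^ 2 := by
  rw [Xinc_eq, mul_pow, mul_pow, mul_pow, hashSgn_sq]
  ring

lemma sqNorm_prefixVec {d : ℕ} (d' : ℕ) (v : Fin d → ℝ) (ω : HashOmega d d') {k : ℕ}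
    (hk : k ≤ d) :
    sqNorm (prefixVec d' v k ω) =
      ∑ j ∈ univ.filter (fun j : Fin d => (j : ℕ) < k), Xinc d' v j ω +
        ∑ j ∈ univ.filter (fun j : Fin d => (j : ℕ) < k), v j ^ 2 := by
  induction k with
  | zero => simp [sqNorm, prefixVec]
  | succ k ih =>
    have h := ih (by omega)
    rw [sum_filter_val_lt_succ hk, sum_filter_val_lt_succ hk]
    simp only [Xinc] at h ⊢
    linarith

/-- The permutation of the sample space that translates the hash value of coordinate `j`
by `c` and leaves everything else unchanged. -/
def shiftHash {d d' : ℕ} [NeZero d'] (j : Fin d) (c : Fin d') :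
    HashOmega d d' ≃ HashOmega d d' :=
  Equiv.prodCongr (Equiv.addRight (Pi.single j c)) (Equiv.refl _)

lemma prefixVec_shiftHash {d d' : ℕ} [NeZero d'] (v : Fin d → ℝ) (j : Fin d) (c : Fin d')
    {k : ℕ} (hk : k ≤ j) (ω : HashOmega d d') :
    prefixVec d' v k (shiftHash j c ω) = prefixVec d' v k ω := by
  ext i
  rw [prefixVec_apply, prefixVec_apply]
  refine sum_congr rfl fun l hl => ?_
  have hlj : l ≠ j := by
    rintro rfl
    simp only [mem_filter, mem_univ, true_and] at hl
    omega
  simp [shiftHash, hashSgn, Pi.single_eq_of_ne hlj]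

lemma shiftHash_fst_self {d d' : ℕ} [NeZero d'] (j : Fin d) (c : Fin d')
    (ω : HashOmega d d') : (shiftHash j c ω).1 j = ω.1 j + c := by
  simp [shiftHash]

lemma sum_Xinc_sq_shiftHash {d d' : ℕ} [NeZero d'] (v : Fin d → ℝ) (j : Fin d)
    (ω : HashOmega d d') :
    ∑ c : Fin d', Xinc d' v j (shiftHash j c ω) ^ 2 =
      4 * v j ^ 2 * sqNorm (prefixVec d' v j ω) := by
  simp only [Xinc_sq, prefixVec_shiftHash v j _ le_rfl, shiftHash_fst_self]
  rw [← mul_sum, sqNorm,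
    ← Equiv.sum_comp (Equiv.addLeft (ω.1 j)) (fun i => prefixVec d' v j ω i ^ 2)]
  rfl

lemma XFilt_le {d : ℕ} (d' : ℕ) (v : Fin d → ℝ) (j : Fin d) :
    XFilt d' v j ≤ (inferInstance : MeasurableSpace (HashOmega d d')) :=
  iSup₂_le fun _ _ => (measurable_of_finite _).comap_le

lemma shiftHash_mem_iff {d d' : ℕ} [NeZero d'] (v : Fin d → ℝ) (j : Fin d) (c : Fin d')
    {s : Set (HashOmega d d')} (hs : MeasurableSet[XFilt d' v j] s) (ω : HashOmega d d') :
    shiftHash j c ω ∈ s ↔ ω ∈ s := by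
  have hle : XFilt d' v j ≤ MeasurableSpace.invariants (shiftHash j c) := by
    refine iSup₂_le fun i hi => ?_
    rintro _ ⟨t, -, rfl⟩
    refine MeasurableSpace.measurableSet_invariants.2 ⟨MeasurableSet.of_discrete, ?_⟩
    ext ω'
    have hij : (i : ℕ) < j := hi
    simp only [Set.mem_preimage, Xinc, prefixVec_shiftHash v j c hij,
      prefixVec_shiftHash v j c hij.le]
  exact Set.ext_iff.1 (MeasurableSpace.measurableSet_invariants.1 (hle s hs)).2 ω

instance isProbabilityMeasure_hashUnif (d d' : ℕ) [NeZero d'] :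
    IsProbabilityMeasure (hashUnif d d') := by
  unfold hashUnif
  infer_instance

lemma integral_hashUnif (d d' : ℕ) [NeZero d'] (f : HashOmega d d' → ℝ) :
    ∫ ω, f ω ∂hashUnif d d' = (Fintype.card (HashOmega d d') : ℝ)⁻¹ * ∑ ω, f ω := by
  rw [hashUnif, PMF.integral_eq_sum, mul_sum]
  simp

lemma setIntegral_Xinc_sq {d d' : ℕ} [NeZero d'] (v : Fin d → ℝ) (j : Fin d)
    {s : Set (HashOmega d d')} (hs : MeasurableSet[XFilt d' v j] s) :
    ∫ ω in s, Xinc d' v j ω ^ 2 ∂hashUnif d d' =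
      ∫ ω in s, 4 * v j ^ 2 / d' * sqNorm (prefixVec d' v j ω) ∂hashUnif d d' := by
  classical
  have hd' : (d' : ℝ) ≠ 0 := NeZero.ne _
  rw [← integral_indicator MeasurableSet.of_discrete,
    ← integral_indicator MeasurableSet.of_discrete, integral_hashUnif, integral_hashUnif]
  congr 1
  have havg : (d' : ℝ) * ∑ ω, s.indicator (fun ω => Xinc d' v j ω ^ 2) ω =
      ∑ c : Fin d', ∑ ω, s.indicator (fun ω => Xinc d' v j ω ^ 2) (shiftHash j c ω) := by
    simp only [Equiv.sum_comp, sum_const, card_univ, Fintype.card_fin, nsmul_eq_mul]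
  apply mul_left_cancel₀ hd'
  rw [havg, sum_comm, mul_sum]
  refine sum_congr rfl fun ω _ => ?_
  simp only [Set.indicator_apply, shiftHash_mem_iff v j _ hs]
  split_ifs
  · rw [sum_Xinc_sq_shiftHash]
    field_simp
  · simp

lemma measurable_sqNorm_prefixVec {d : ℕ} (d' : ℕ) (v : Fin d → ℝ) (j : Fin d) :
    Measurable[XFilt d' v j] fun ω => sqNorm (prefixVec d' v j ω) := by
  simp only [sqNorm_prefixVec d' v _ j.isLt.le]
  refine Measurable.add_const (Finset.measurable_sum _ fun i hi => ?_) _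
  have hij : i < j := (mem_filter.1 hi).2
  exact (comap_measurable (Xinc d' v i)).mono (le_iSup₂_of_le i hij le_rfl) le_rfl

/-- The conditional second moment of the increment `X_j` given the previous increments. -/
lemma condExp_Xinc_sq {d d' : ℕ} [NeZero d'] (v : Fin d → ℝ) (j : Fin d) :
    (hashUnif d d')[fun ω => Xinc d' v j ω ^ 2 | XFilt d' v j] =ᵐ[hashUnif d d']
      fun ω => 4 * v j ^ 2 / d' * sqNorm (prefixVec d' v j ω) := by
  refine (ae_eq_condExp_of_forall_setIntegral_eq (XFilt_le d' v j) .of_finite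
    (fun _ _ _ => Integrable.of_finite.integrableOn)
    (fun s hs _ => (setIntegral_Xinc_sq v j hs).symm) ?_).symm
  exact ((measurable_sqNorm_prefixVec d' v j).const_mul _).stronglyMeasurable.aestronglyMeasurable

/-- **Reduction of the deviation event to a stopped-martingale event.**
With `h`, `sgn` independent uniformly random, `‖v‖₂ = 1`, `v' = v'^{(d)}`,
`X_{≤k} = ∑_{i=1}^k X_i` and `V_k = ∑_{i=1}^k E[X_i² | X₁,…,X_{i−1}]`, for every
`ε ∈ (0,1)`:
`Pr[|‖v'‖₂² − 1| ≥ ε] ≤ Pr[∃k ∈ {1,…,d} : |X_{≤k}| ≥ ε ∧ V_k ≤ 8/d']`. -/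
theorem deviation_event_reduction
    (d d' : ℕ) [NeZero d] [NeZero d'] (v : Fin d → ℝ)
    (hv : ∑ j, (v j) ^ 2 = 1)
    (ε : ℝ) (hε : ε ∈ Set.Ioo (0 : ℝ) 1) :
    hashUnif d d' {ω | ε ≤ |sqNorm (prefixVec d' v d ω) - 1|} ≤
      hashUnif d d' {ω | ∃ k ∈ Finset.Icc 1 d,
        ε ≤ |∑ j ∈ univ.filter (fun j : Fin d => (j : ℕ) < k), Xinc d' v j ω| ∧
        (∑ j ∈ univ.filter (fun j : Fin d => (j : ℕ) < k),
            ((hashUnif d d')[fun ω' => (Xinc d' v j ω') ^ 2 | XFilt d' v j]) ω) ≤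
          8 / (d' : ℝ)} := by
  have hd' : (0 : ℝ) < d' := Nat.cast_pos.2 (NeZero.pos d')
  have hall : ∀ᵐ ω ∂hashUnif d d', ∀ j : Fin d,
      ((hashUnif d d')[fun ω' => (Xinc d' v j ω') ^ 2 | XFilt d' v j]) ω =
        4 * v j ^ 2 / d' * sqNorm (prefixVec d' v j ω) :=
    ae_all_iff.2 fun j => condExp_Xinc_sq v j
  refine measure_mono_ae ?_
  filter_upwards [hall] with ω hω (hdev : ε ≤ |sqNorm (prefixVec d' v d ω) - 1|)
  set S : ℕ → ℝ := fun k => ∑ j ∈ univ.filter (fun j : Fin d => (j : ℕ) < k), Xinc d' v j ω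
  have hex : ∃ k, k ≤ d ∧ ε ≤ |S k| := by
    refine ⟨d, le_rfl, ?_⟩
    rw [sqNorm_prefixVec d' v ω le_rfl] at hdev
    simpa [S, hv] using hdev
  obtain ⟨hkd, hkε⟩ := Nat.find_spec hex
  set k := Nat.find hex
  have hk0 : k ≠ 0 := by
    intro h0
    rw [h0] at hkε
    simp only [S, not_lt_zero, filter_false, sum_empty, abs_zero] at hkε
    exact absurd hkε (not_le.2 hε.1)
  refine ⟨k, mem_Icc.2 ⟨Nat.one_le_iff_ne_zero.2 hk0, hkd⟩, hkε, ?_⟩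
  have hpartial : ∀ s : Finset (Fin d), ∑ j ∈ s, v j ^ 2 ≤ 1 := fun s =>
    hv ▸ sum_le_univ_sum_of_nonneg fun j => sq_nonneg _
  calc ∑ j ∈ univ.filter (fun j : Fin d => (j : ℕ) < k),
        ((hashUnif d d')[fun ω' => (Xinc d' v j ω') ^ 2 | XFilt d' v j]) ω
      ≤ ∑ j ∈ univ.filter (fun j : Fin d => (j : ℕ) < k), 8 / (d' : ℝ) * v j ^ 2 := by
        refine sum_le_sum fun j hj => ?_
        have hjk : (j : ℕ) < k := (mem_filter.1 hj).2
        have hlt : |S j| < ε := by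
          by_contra! hle
          exact Nat.find_min hex hjk ⟨j.isLt.le, hle⟩
        have hnorm : sqNorm (prefixVec d' v j ω) ≤ 2 := by
          rw [sqNorm_prefixVec d' v ω j.isLt.le]
          have h1 := (abs_lt.1 hlt).2
          have h2 := hpartial (univ.filter fun i : Fin d => (i : ℕ) < j)
          have h3 := hε.2
          simp only [S] at h1
          linarith
        rw [hω j]
        calc 4 * v j ^ 2 / d' * sqNorm (prefixVec d' v j ω)
            ≤ 4 * v j ^ 2 / d' * 2 := by gcongr
          _ = 8 / d' * v j ^ 2 := by ring
    _ = 8 / d' * ∑ j ∈ univ.filter (fun j : Fin d => (j : ℕ) < k), v j ^ 2 := by rw [mul_sum]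
    _ ≤ 8 / d' * 1 := by
        gcongr
        exact hpartial _
    _ = 8 / d' := mul_one _

end
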